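/- Let K = (𝕊¹ × {1,2}) / ((1,1) ∼ (1,2)) be the figure-eight space (two circles glued at the point 1), with the quotient topology, and let P₂ : K → K be the continuous map induced by (z, i) ↦ (z², i). Then the inverse limit lim(K, P₂) is homeomorphic to the wedge S₂ ∨ S₂ of two copies of the dyadic solenoid glued at the constant thread (1,1,1,…), i.e. to the quotient (S₂ × {1,2}) / (((1,1,1,…),1) ∼ ((1,1,1,…),2)) with the quotient topology. -/

import Mathlib

/-- The circle `𝕊¹ = {z ∈ ℂ | |z| = 1}`. -/
def Circ : Type := {z : ℂ // ‖z‖ = 1}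

instance : TopologicalSpace Circ :=
  inferInstanceAs (TopologicalSpace {z : ℂ // ‖z‖ = 1})

/-- The relation on `𝕊¹ × {1,2}` gluing `(1,1)` with `(1,2)`. -/
def eightRel (p q : Circ × Bool) : Prop := p.1.1 = 1 ∧ q.1.1 = 1

/-- The figure-eight space `K = (𝕊¹ × {1,2}) / ((1,1) ∼ (1,2))`. -/
def Eight : Type := Quot eightRel

instance : TopologicalSpace Eight := inferInstanceAs (TopologicalSpace (Quot eightRel))

/-- The squaring map on `𝕊¹ × {1,2}`. -/
def sqPair (p : Circ × Bool) : Circ × Bool :=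
  (⟨p.1.1 ^ 2, by rw [norm_pow, p.1.2, one_pow]⟩, p.2)

/-- The map `P₂ : K → K` induced by `(z, i) ↦ (z², i)`. -/
def P₂ : Eight → Eight :=
  Quot.map sqPair (fun p q h => ⟨by simp [sqPair, h.1], by simp [sqPair, h.2]⟩)

/-- The dyadic solenoid `S₂`. -/
def DyadicSolenoid : Type :=
  {z : ℕ → ℂ // (∀ k, ‖z k‖ = 1) ∧ ∀ k, z (k + 1) ^ 2 = z k}

instance : TopologicalSpace DyadicSolenoid :=
  inferInstanceAs
    (TopologicalSpace
      {z : ℕ → ℂ // (∀ k, ‖z k‖ = 1) ∧ ∀ k, z (k + 1) ^ 2 = z k})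

/-- The constant thread `(1, 1, 1, …) ∈ S₂`. -/
def solOne : DyadicSolenoid :=
  ⟨fun _ => 1, ⟨fun _ => by simp, fun _ => by simp⟩⟩

/-- The relation on `S₂ × {1,2}` gluing `((1,1,1,…),1)` with `((1,1,1,…),2)`. -/
def wedgeRel (p q : DyadicSolenoid × Bool) : Prop := p.1 = solOne ∧ q.1 = solOne

/-- The wedge `S₂ ∨ S₂` of two copies of the dyadic solenoid glued at `(1,1,1,…)`. -/
def SolenoidWedge : Type := Quot wedgeRel

instance : TopologicalSpace SolenoidWedge :=
  inferInstanceAs (TopologicalSpace (Quot wedgeRel))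

/-- Coordinate `b` of the figure eight: collapses the other circle to `1`. -/
def rPair (b : Bool) (p : Circ × Bool) : ℂ := if p.2 = b then p.1.1 else 1

theorem continuous_circ_val : Continuous (fun z : Circ => (z.1 : ℂ)) :=
  continuous_subtype_val

theorem rPair_continuous (b : Bool) : Continuous (rPair b) := by
  unfold rPair
  refine Continuous.if ?_ (continuous_circ_val.comp continuous_fst) continuous_const
  intro a ha
  have h : IsClopen {a : Circ × Bool | a.2 = b} :=
    (isClopen_discrete ({b} : Set Bool)).preimage continuous_snd
  rw [h.frontier_eq] at ha
  exact ha.elim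

/-- Coordinate `b` on the quotient. -/
def rE (b : Bool) : Eight → ℂ :=
  Quot.lift (rPair b) (by
    intro p q h
    obtain ⟨h1, h2⟩ := h
    simp [rPair, h1, h2])

theorem rE_mk (b : Bool) (p : Circ × Bool) : rE b (Quot.mk _ p) = rPair b p := rfl

theorem rE_continuous (b : Bool) : Continuous (rE b) :=
  continuous_quot_lift _ (rPair_continuous b)

theorem rE_norm (b : Bool) (x : Eight) : ‖rE b x‖ = 1 := by
  induction x using Quot.ind with
  | mk p =>
    rw [rE_mk, rPair]
    split_ifs
    · exact p.1.2
    · simp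

theorem rE_P₂ (b : Bool) (x : Eight) : rE b (P₂ x) = rE b x ^ 2 := by
  induction x using Quot.ind with
  | mk p =>
    change rPair b (sqPair p) = rPair b p ^ 2
    change (if p.2 = b then p.1.1 ^ 2 else 1) = (if p.2 = b then p.1.1 else 1) ^ 2
    split_ifs
    · rfl
    · simp

theorem rE_or (b : Bool) (x : Eight) : rE b x = 1 ∨ rE (!b) x = 1 := by
  induction x using Quot.ind with
  | mk p =>
    obtain ⟨z, i⟩ := p
    cases b <;> cases i <;> simp [rE_mk, rPair]

theorem rE_inj {x y : Eight} (h : ∀ b, rE b x = rE b y) : x = y := by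
  induction x using Quot.ind with
  | mk p =>
  induction y using Quot.ind with
  | mk q =>
    obtain ⟨z, i⟩ := p
    obtain ⟨w, j⟩ := q
    have h1 := h true
    have h2 := h false
    simp only [rE_mk, rPair] at h1 h2
    by_cases hij : i = j
    · subst hij
      have : z = w := by
        apply Subtype.ext
        cases i <;> simp_all
      rw [this]
    · apply Quot.sound
      cases i <;> cases j <;> simp_all [eightRel]

instance : T2Space Eight :=
  T2Space.of_injective_continuous (f := fun x : Eight => fun b : Bool => rE b x)
    (fun _ _ h => rE_inj (fun b => congrFun h b))
    (continuous_pi fun b => rE_continuous b)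

instance : CompactSpace DyadicSolenoid := by
  have hK : IsCompact (Set.pi Set.univ (fun _ : ℕ => Metric.sphere (0 : ℂ) 1)) :=
    isCompact_univ_pi fun _ => isCompact_sphere 0 1
  have hC : IsClosed {z : ℕ → ℂ | ∀ k, z (k + 1) ^ 2 = z k} := by
    simp only [Set.ofPred_forall]
    exact isClosed_iInter fun k => isClosed_eq (by fun_prop) (by fun_prop)
  have hI := hK.inter_right hC
  have : {z : ℕ → ℂ | (∀ k, ‖z k‖ = 1) ∧ ∀ k, z (k + 1) ^ 2 = z k} =
      Set.pi Set.univ (fun _ : ℕ => Metric.sphere (0 : ℂ) 1) ∩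
        {z : ℕ → ℂ | ∀ k, z (k + 1) ^ 2 = z k} := by
    ext z
    simp [Set.mem_pi]
  rw [← this] at hI
  exact isCompact_iff_compactSpace.mp hI

instance : CompactSpace SolenoidWedge :=
  inferInstanceAs (CompactSpace (Quot wedgeRel))

/-- The inverse limit. -/
abbrev ELim : Type := {x : ℕ → Eight // ∀ k, P₂ (x (k + 1)) = x k}

/-- The map from `S₂ × {1,2}` to the inverse limit. -/
def toLimPair (p : DyadicSolenoid × Bool) : ELim :=
  ⟨fun k => Quot.mk _ (⟨p.1.1 k, p.1.2.1 k⟩, p.2), fun k => by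
    change Quot.mk _ (sqPair _) = _
    congr 1
    refine Prod.ext (Subtype.ext ?_) rfl
    exact p.1.2.2 k⟩

theorem toLimPair_continuous : Continuous toLimPair := by
  refine Continuous.subtype_mk (continuous_pi fun k => ?_) _
  refine continuous_quot_mk.comp ?_
  refine Continuous.prodMk ?_ continuous_snd
  refine Continuous.subtype_mk ?_ _
  exact (continuous_apply k).comp (continuous_subtype_val.comp continuous_fst)

theorem rE_toLimPair (b : Bool) (p : DyadicSolenoid × Bool) (k : ℕ) :
    rE b ((toLimPair p).1 k) = if p.2 = b then p.1.1 k else 1 := rfl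

/-- The map from the wedge to the inverse limit. -/
def toLim : SolenoidWedge → ELim :=
  Quot.lift toLimPair (by
    rintro ⟨z, i⟩ ⟨w, j⟩ ⟨h1, h2⟩
    simp only at h1 h2
    subst h1 h2
    refine Subtype.ext (funext fun k => rE_inj fun b => ?_)
    simp [rE_toLimPair, solOne])

theorem toLim_continuous : Continuous toLim :=
  continuous_quot_lift _ toLimPair_continuous

theorem toLim_injective : Function.Injective toLim := by
  intro x y h
  induction x using Quot.ind with
  | mk p =>
  induction y using Quot.ind with
  | mk q =>
    obtain ⟨z, i⟩ := p
    obtain ⟨w, j⟩ := q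
    have h' : ∀ b k, (if i = b then z.1 k else 1) = (if j = b then w.1 k else 1) := by
      intro b k
      have : toLimPair (z, i) = toLimPair (w, j) := h
      have h2 := congrArg (fun t : ELim => rE b (t.1 k)) this
      simpa only [rE_toLimPair] using h2
    by_cases hij : i = j
    · subst hij
      have : z = w := by
        refine Subtype.ext (funext fun k => ?_)
        simpa using h' i k
      rw [this]
    · apply Quot.sound
      refine ⟨Subtype.ext (funext fun k => ?_), Subtype.ext (funext fun k => ?_)⟩
      · change z.1 k = 1
        simpa [Ne.symm hij] using h' i k
      · change w.1 k = 1
        simpa [hij] using (h' j k).symm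

theorem rE_stable (b : Bool) (x : ELim) (k n : ℕ) (h : rE b (x.1 (k + n)) = 1) :
    rE b (x.1 k) = 1 := by
  induction n with
  | zero => exact h
  | succ n ih =>
    apply ih
    rw [← x.2 (k + n), rE_P₂]
    rw [← add_assoc] at h
    rw [h, one_pow]

theorem exists_side (x : ELim) : ∃ b : Bool, ∀ k, rE (!b) (x.1 k) = 1 := by
  by_contra! hcon
  obtain ⟨k, hk⟩ := hcon true
  obtain ⟨l, hl⟩ := hcon false
  rcases rE_or true (x.1 (k + l)) with h | h
  · rw [add_comm] at h
    exact hl (rE_stable _ x l k h)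
  · exact hk (rE_stable _ x k l h)

theorem toLim_surjective : Function.Surjective toLim := by
  intro x
  obtain ⟨b, hb⟩ := exists_side x
  refine ⟨Quot.mk _ (⟨fun k => rE b (x.1 k), fun k => rE_norm b _, fun k => ?_⟩, b), ?_⟩
  · rw [← rE_P₂, x.2 k]
  · refine Subtype.ext (funext fun k => rE_inj fun c => ?_)
    change rE c ((toLimPair _).1 k) = _
    rw [rE_toLimPair]
    by_cases hc : b = c
    · subst hc
      simp
    · have hcb : c = !b := by
        cases b <;> cases c <;> simp_all
      subst hcb
      simp [hb k]

/-- **The inverse limit of the figure eight under the doubling map is a wedge of two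
solenoids** (and, in particular, is not a lamination): `lim (K, P₂) ≃ₜ S₂ ∨ S₂`. -/
theorem inverse_limit_figureEight_homeomorph_wedge :
    Nonempty
      ({x : ℕ → Eight // ∀ k, P₂ (x (k + 1)) = x k} ≃ₜ SolenoidWedge) := by
  exact ⟨(Continuous.homeoOfEquivCompactToT2
    (f := Equiv.ofBijective toLim ⟨toLim_injective, toLim_surjective⟩)
    toLim_continuous).symm⟩
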